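/- arXiv:2402.02171 — 11 statements merged into one kernel-verified Lean document; each statement's English description precedes it below -/
import Mathlib

section
/- Assume the slate abstraction φ is sufficient. Then the LIPS estimator is unbiased: ∑_x p(x) ∑_s π₀(s|x) · w(x, φ(s)) · q(x,s) = V(π), where w(x,z) := π(z|x)/π₀(z|x) is the latent importance weight. -/
/-- Unbiasedness of LIPS under a sufficient deterministic slate abstraction:
if `φ` is sufficient (i.e. `q x` is constant on the fibers of `φ`), then
`∑_x p x ∑_s π₀(s|x) · w(x, φ(s)) · q(x,s) = V(π)`, where
`w(x,z) = π(z|x) / π₀(z|x)` is the latent importance weight built from the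
marginals `π(z|x) = ∑_{s : φ s = z} π(s|x)`. -/
theorem lips_unbiased_sufficient
    {X S Z : Type*} [Fintype X] [Fintype S] [Fintype Z] [DecidableEq Z] [Nonempty X] [Nonempty S]
    (p : X → ℝ) (hp0 : ∀ x, 0 ≤ p x) (hp1 : ∑ x, p x = 1)
    (pi pi0 : X → S → ℝ)
    (hpi0 : ∀ x s, 0 ≤ pi x s) (hpi1 : ∀ x, ∑ s, pi x s = 1)
    (hpi0pos : ∀ x s, 0 < pi0 x s) (hpi01 : ∀ x, ∑ s, pi0 x s = 1)
    (q : X → S → ℝ) (φ : S → Z)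
    (hsuff : ∀ x s s', φ s = φ s' → q x s = q x s') :
    ∑ x, p x * ∑ s, pi0 x s *
        ((∑ s' ∈ Finset.univ.filter (fun s' => φ s' = φ s), pi x s') /
          (∑ s' ∈ Finset.univ.filter (fun s' => φ s' = φ s), pi0 x s') * q x s)
      = ∑ x, p x * ∑ s, pi x s * q x s := by
  refine Finset.sum_congr rfl fun x _ => ?_
  congr 1
  rw [← Finset.sum_fiberwise Finset.univ φ (fun s => pi x s * q x s),
    ← Finset.sum_fiberwise Finset.univ φ]
  refine Finset.sum_congr rfl fun z _ => ?_
  rcases (Finset.univ.filter (fun s => φ s = z)).eq_empty_or_nonempty with he | ⟨s0, hs0⟩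
  · rw [he]; simp
  · have hz : φ s0 = z := (Finset.mem_filter.mp hs0).2
    have hpos : 0 < ∑ s ∈ Finset.univ.filter (fun s => φ s = z), pi0 x s :=
      Finset.sum_pos (fun s _ => hpi0pos x s) ⟨s0, hs0⟩
    have h1 : ∀ s ∈ Finset.univ.filter (fun s => φ s = z), pi x s * q x s = pi x s * q x s0 := by
      intro s hs
      rw [hsuff x s s0 ((Finset.mem_filter.mp hs).2.trans hz.symm)]
    rw [Finset.sum_congr rfl h1, ← Finset.sum_mul]
    have h2 : ∀ s ∈ Finset.univ.filter (fun s => φ s = z),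
        pi0 x s * ((∑ s' ∈ Finset.univ.filter (fun s' => φ s' = φ s), pi x s') /
          (∑ s' ∈ Finset.univ.filter (fun s' => φ s' = φ s), pi0 x s') * q x s)
        = pi0 x s * ((∑ s' ∈ Finset.univ.filter (fun s' => φ s' = z), pi x s') /
          (∑ s' ∈ Finset.univ.filter (fun s' => φ s' = z), pi0 x s') * q x s0) := by
      intro s hs
      have hs' := (Finset.mem_filter.mp hs).2
      rw [hsuff x s s0 (hs'.trans hz.symm), hs']
    rw [Finset.sum_congr rfl h2, ← Finset.sum_mul]
    field_simp
end

section
/- Fix an enumeration s₁, …, s_{|S|} of S. The bias of LIPS under a stochastic slate abstraction p_θ satisfies: Bias = ∑_x p(x) ∑_{z : p_θ(z|x;π₀)>0} p_θ(z|x;π₀) · ∑_{1 ≤ j < k ≤ |S|} p_θ(s_j|x,z;π₀) p_θ(s_k|x,z;π₀) · (q(x,s_j) − q(x,s_k)) · (w(x,s_k) − w(x,s_j)). -/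
theorem pair_sum_aux {n : ℕ} (a q w : Fin n → ℝ) :
    ∑ j, ∑ k ∈ Finset.univ.filter (fun k => j < k),
      a j * a k * (q j - q k) * (w k - w j)
    = (∑ j, a j * q j) * (∑ j, a j * w j) - (∑ j, a j) * ∑ j, a j * q j * w j := by
  have h1 : ∑ j, ∑ k, a j * a k * (q j - q k) * (w k - w j)
      = 2 * ((∑ j, a j * q j) * (∑ j, a j * w j) - (∑ j, a j) * ∑ j, a j * q j * w j) := by
    have e1 : ∀ j k, a j * a k * (q j - q k) * (w k - w j)
        = (a j * q j) * (a k * w k) + (a j * w j) * (a k * q k)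
          - (a j * q j * w j) * a k - a j * (a k * q k * w k) := by
      intro j k; ring
    simp only [e1, Finset.sum_sub_distrib, Finset.sum_add_distrib, ← Finset.mul_sum,
      ← Finset.sum_mul]
    ring
  have h2 : ∑ j, ∑ k, a j * a k * (q j - q k) * (w k - w j)
      = (∑ j, ∑ k, if j < k then a j * a k * (q j - q k) * (w k - w j) else 0)
      + ∑ j, ∑ k, if k < j then a j * a k * (q j - q k) * (w k - w j) else 0 := by
    rw [← Finset.sum_add_distrib]
    refine Finset.sum_congr rfl fun j _ => ?_
    rw [← Finset.sum_add_distrib]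
    refine Finset.sum_congr rfl fun k _ => ?_
    rcases lt_trichotomy j k with h | h | h
    · simp [h, h.not_gt]
    · subst h; simp
    · simp [h, h.not_gt]
  have h3 : (∑ j, ∑ k, if k < j then a j * a k * (q j - q k) * (w k - w j) else 0)
      = ∑ j, ∑ k, if j < k then a j * a k * (q j - q k) * (w k - w j) else 0 := by
    rw [Finset.sum_comm]
    refine Finset.sum_congr rfl fun j _ => Finset.sum_congr rfl fun k _ => ?_
    split_ifs
    · ring
    · rfl
  simp only [Finset.sum_filter]
  linarith

/-- Bias of LIPS under a stochastic slate abstraction (Theorem 3.3 / "Bias of LIPS"):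
with an enumeration `e : Fin |S| ≃ S` of the slates, the bias of LIPS equals
`∑_x p(x) ∑_{z : p_θ(z|x;π₀)>0} p_θ(z|x;π₀) ∑_{j<k} p_θ(s_j|x,z;π₀) p_θ(s_k|x,z;π₀)
  (q(x,s_j) − q(x,s_k)) (w(x,s_k) − w(x,s_j))`. -/
theorem lips_bias_formula
    {X S Z : Type*} [Fintype X] [Fintype S] [Fintype Z] [Nonempty X] [Nonempty S]
    (p : X → ℝ) (hp0 : ∀ x, 0 ≤ p x) (hp1 : ∑ x, p x = 1)
    (pi pi0 : X → S → ℝ)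
    (hpi0 : ∀ x s, 0 ≤ pi x s) (hpi1 : ∀ x, ∑ s, pi x s = 1)
    (hpi0pos : ∀ x s, 0 < pi0 x s) (hpi01 : ∀ x, ∑ s, pi0 x s = 1)
    (q : X → S → ℝ)
    (ptheta : X → S → Z → ℝ)
    (hpt0 : ∀ x s z, 0 ≤ ptheta x s z) (hpt1 : ∀ x s, ∑ z, ptheta x s z = 1)
    (w : X → S → ℝ) (hw : ∀ x s, w x s = pi x s / pi0 x s)
    (marg : (X → S → ℝ) → X → Z → ℝ)
    (hmarg : ∀ mu x z, marg mu x z = ∑ s, mu x s * ptheta x s z)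
    (wtheta : X → Z → ℝ) (hwtheta : ∀ x z, wtheta x z = marg pi x z / marg pi0 x z)
    (post : X → Z → S → ℝ)
    (hpost : ∀ x z s, post x z s = pi0 x s * ptheta x s z / marg pi0 x z)
    (V Bias : ℝ)
    (hV : V = ∑ x, p x * ∑ s, pi x s * q x s)
    (hBias : Bias = (∑ x, p x * ∑ s, pi0 x s * ∑ z, ptheta x s z * (wtheta x z * q x s)) - V)
    (e : Fin (Fintype.card S) ≃ S) :
    Bias = ∑ x, p x * ∑ z ∈ Finset.univ.filter (fun z => 0 < marg pi0 x z),
      marg pi0 x z *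
        ∑ j, ∑ k ∈ Finset.univ.filter (fun k => j < k),
          post x z (e j) * post x z (e k) * (q x (e j) - q x (e k)) *
            (w x (e k) - w x (e j)) := by
  subst hBias hV
  rw [← Finset.sum_sub_distrib]
  refine Finset.sum_congr rfl fun x _ => ?_
  rw [← mul_sub]
  congr 1
  have hA : ∑ s, pi0 x s * ∑ z, ptheta x s z * (wtheta x z * q x s)
      = ∑ z, ∑ s, pi0 x s * ptheta x s z * (wtheta x z * q x s) := by
    rw [Finset.sum_comm]
    refine Finset.sum_congr rfl fun s _ => ?_
    rw [Finset.mul_sum]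
    exact Finset.sum_congr rfl fun z _ => by ring
  have hB : ∑ s, pi x s * q x s = ∑ z, ∑ s, pi x s * ptheta x s z * q x s := by
    rw [Finset.sum_comm]
    refine Finset.sum_congr rfl fun s _ => ?_
    have : ∑ z, pi x s * ptheta x s z * q x s = pi x s * q x s * ∑ z, ptheta x s z := by
      rw [Finset.mul_sum]
      exact Finset.sum_congr rfl fun z _ => by ring
    rw [this, hpt1, mul_one]
  rw [hA, hB, ← Finset.sum_sub_distrib, Finset.sum_filter]
  refine Finset.sum_congr rfl fun z _ => ?_
  have hnn : ∀ s ∈ Finset.univ, 0 ≤ pi0 x s * ptheta x s z :=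
    fun s _ => mul_nonneg (hpi0pos x s).le (hpt0 x s z)
  split_ifs with hm
  · rw [pair_sum_aux (fun j => post x z (e j)) (fun j => q x (e j)) (fun j => w x (e j))]
    rw [e.sum_comp (fun s => post x z s * q x s), e.sum_comp (fun s => post x z s * w x s),
      e.sum_comp (fun s => post x z s), e.sum_comp (fun s => post x z s * q x s * w x s)]
    have hne := hm.ne'
    have s1 : ∑ s, post x z s = 1 := by
      simp only [hpost, ← Finset.sum_div]
      rw [← hmarg, div_self hne]
    have s2 : ∑ s, post x z s * w x s = wtheta x z := by
      rw [hwtheta, hmarg pi, Finset.sum_div]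
      refine Finset.sum_congr rfl fun s _ => ?_
      rw [hpost, hw]
      have := (hpi0pos x s).ne'
      field_simp
    rw [s1, s2, one_mul, mul_sub, Finset.sum_mul, Finset.mul_sum, Finset.mul_sum]
    congr 1
    · refine Finset.sum_congr rfl fun s _ => ?_
      rw [hpost]
      field_simp
    · refine Finset.sum_congr rfl fun s _ => ?_
      rw [hpost, hw]
      have := (hpi0pos x s).ne'
      field_simp
  · have h0 : ∑ s, pi0 x s * ptheta x s z = 0 := by
      refine le_antisymm ?_ (Finset.sum_nonneg hnn)
      rw [← hmarg]; exact not_lt.mp hm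
    have hz : ∀ s, ptheta x s z = 0 := fun s => by
      have := (Finset.sum_eq_zero_iff_of_nonneg hnn).1 h0 s (Finset.mem_univ s)
      exact (mul_eq_zero.1 this).resolve_left (hpi0pos x s).ne'
    simp [hz]
end

section
/- Assume the reward distribution depends only on the context and the abstraction, i.e., p_r(·|x,s) = p_r(·|x,s') whenever φ(s) = φ(s') (in particular φ is a sufficient abstraction), and write m₂(x,z) for the common second moment m₂(x,s) for any s with φ(s) = z. Then the single-sample variance reduction of LIPS over IPS equals: Var[w(x,s)·r] − Var[w(x,φ(s))·r] = ∑_x p(x) ∑_{z ∈ φ(S)} π₀(z|x) · m₂(x,z) · Var_{π₀(·|x,z)}[w(x,·)], where (x,s,r) is drawn from p(x) π₀(s|x) p_r(r|x,s), π₀(s'|x,z) := π₀(s'|x)/π₀(z|x) for φ(s') = z (and 0 otherwise), w(x,z) := π(z|x)/π₀(z|x), and Var_{π₀(·|x,z)}[w(x,·)] := ∑_{s'} π₀(s'|x,z) w(x,s')² − (∑_{s'} π₀(s'|x,z) w(x,s'))². (Since the n-sample IPS and LIPS estimators are averages of n i.i.d. copies of these single-sample statistics, this quantity equals n·(V_D[IPS]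 − V_D[LIPS]).) -/
/-- Variance reduction of LIPS over IPS (Theorem "Variance Reduction"): if the
reward distribution depends on the slate only through the abstraction `φ`
(in particular `φ` is sufficient), then the single-sample variance reduction is
`Var[w(x,s)·r] − Var[w(x,φ(s))·r]
  = ∑_x p(x) ∑_{z ∈ φ(S)} π₀(z|x) · m₂(x,z) · Var_{π₀(·|x,z)}[w(x,·)]`. -/
theorem lips_variance_reduction
    {X S Z : Type*} [Fintype X] [Fintype S] [Fintype Z] [DecidableEq Z]
    [Nonempty X] [Nonempty S]
    (p : X → ℝ) (hp0 : ∀ x, 0 ≤ p x) (hp1 : ∑ x, p x = 1)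
    (pi pi0 : X → S → ℝ)
    (hpi0 : ∀ x s, 0 ≤ pi x s) (hpi1 : ∀ x, ∑ s, pi x s = 1)
    (hpi0pos : ∀ x s, 0 < pi0 x s) (hpi01 : ∀ x, ∑ s, pi0 x s = 1)
    (R : Finset ℝ) (pr : X → S → ℝ → ℝ)
    (hpr0 : ∀ x s, ∀ r ∈ R, 0 ≤ pr x s r) (hpr1 : ∀ x s, ∑ r ∈ R, pr x s r = 1)
    (φ : S → Z)
    -- the reward distribution depends only on the context and the abstraction
    (hprdep : ∀ x s s', φ s = φ s' → ∀ r, pr x s r = pr x s' r)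
    (m2 : X → S → ℝ) (hm2 : ∀ x s, m2 x s = ∑ r ∈ R, pr x s r * r ^ 2)
    (m2z : X → Z → ℝ) (hm2z : ∀ x s, m2z x (φ s) = m2 x s)
    (w : X → S → ℝ) (hw : ∀ x s, w x s = pi x s / pi0 x s)
    (marg : (X → S → ℝ) → X → Z → ℝ)
    (hmarg : ∀ mu x z, marg mu x z = ∑ s ∈ Finset.univ.filter (fun s => φ s = z), mu x s)
    (wz : X → Z → ℝ) (hwz : ∀ x z, wz x z = marg pi x z / marg pi0 x z)
    (cond : X → Z → S → ℝ)
    (hcond : ∀ x z s, cond x z s = if φ s = z then pi0 x s / marg pi0 x z else 0) :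
    -- Var of the single-sample IPS statistic minus Var of the LIPS statistic
    (((∑ x, p x * ∑ s, pi0 x s * ∑ r ∈ R, pr x s r * (w x s * r) ^ 2) -
        (∑ x, p x * ∑ s, pi0 x s * ∑ r ∈ R, pr x s r * (w x s * r)) ^ 2) -
      ((∑ x, p x * ∑ s, pi0 x s * ∑ r ∈ R, pr x s r * (wz x (φ s) * r) ^ 2) -
        (∑ x, p x * ∑ s, pi0 x s * ∑ r ∈ R, pr x s r * (wz x (φ s) * r)) ^ 2))
      = ∑ x, p x * ∑ z ∈ Finset.univ.image φ,
          marg pi0 x z * m2z x z *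
            ((∑ s, cond x z s * (w x s) ^ 2) - (∑ s, cond x z s * w x s) ^ 2) := by
  have fib : ∀ F : S → ℝ, ∑ s, F s = ∑ z ∈ Finset.univ.image φ,
      ∑ s ∈ Finset.univ.filter (fun s => φ s = z), F s := by
    intro F
    exact (Finset.sum_fiberwise_of_maps_to
      (fun s _ => Finset.mem_image_of_mem φ (Finset.mem_univ s)) F).symm
  have hM : ∀ x s0, 0 < marg pi0 x (φ s0) := by
    intro x s0
    rw [hmarg]
    exact Finset.sum_pos (fun s _ => hpi0pos x s) ⟨s0, by simp⟩
  have hpw : ∀ x s, pi0 x s * w x s = pi x s := by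
    intro x s
    rw [hw]
    have := (hpi0pos x s).ne'
    field_simp
  have hmean : ∀ x, ∑ s, pi0 x s * ∑ r ∈ R, pr x s r * (w x s * r)
      = ∑ s, pi0 x s * ∑ r ∈ R, pr x s r * (wz x (φ s) * r) := by
    intro x
    rw [fib, fib]
    refine Finset.sum_congr rfl fun z hz => ?_
    obtain ⟨s0, -, rfl⟩ := Finset.mem_image.1 hz
    have h1 : ∀ s ∈ Finset.univ.filter (fun s => φ s = φ s0),
        pi0 x s * ∑ r ∈ R, pr x s r * (w x s * r)
          = pi x s * ∑ r ∈ R, pr x s0 r * r := by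
      intro s hs
      rw [← hpw, mul_assoc, Finset.mul_sum _ _ (w x s)]
      congr 1
      refine Finset.sum_congr rfl fun r _ => ?_
      rw [hprdep x s s0 (Finset.mem_filter.1 hs).2]; ring
    have h2 : ∀ s ∈ Finset.univ.filter (fun s => φ s = φ s0),
        pi0 x s * ∑ r ∈ R, pr x s r * (wz x (φ s) * r)
          = pi0 x s * (wz x (φ s0) * ∑ r ∈ R, pr x s0 r * r) := by
      intro s hs
      rw [Finset.mul_sum _ _ (wz x (φ s0))]
      congr 1
      refine Finset.sum_congr rfl fun r _ => ?_
      rw [hprdep x s s0 (Finset.mem_filter.1 hs).2, (Finset.mem_filter.1 hs).2]; ring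
    rw [Finset.sum_congr rfl h1, Finset.sum_congr rfl h2, ← Finset.sum_mul, ← Finset.sum_mul,
      ← hmarg, ← hmarg, hwz]
    have := (hM x s0).ne'
    field_simp
  have hsec : ∀ x, (∑ s, pi0 x s * ∑ r ∈ R, pr x s r * (w x s * r) ^ 2)
      - (∑ s, pi0 x s * ∑ r ∈ R, pr x s r * (wz x (φ s) * r) ^ 2)
      = ∑ z ∈ Finset.univ.image φ, marg pi0 x z * m2z x z *
            ((∑ s, cond x z s * (w x s) ^ 2) - (∑ s, cond x z s * w x s) ^ 2) := by
    intro x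
    rw [fib, fib, ← Finset.sum_sub_distrib]
    refine Finset.sum_congr rfl fun z hz => ?_
    obtain ⟨s0, -, rfl⟩ := Finset.mem_image.1 hz
    have hne := (hM x s0).ne'
    have h1 : ∀ s ∈ Finset.univ.filter (fun s => φ s = φ s0),
        pi0 x s * ∑ r ∈ R, pr x s r * (w x s * r) ^ 2
          = (pi0 x s * w x s ^ 2) * m2 x s0 := by
      intro s hs
      rw [hm2, mul_assoc, Finset.mul_sum _ _ (w x s ^ 2)]
      congr 1
      refine Finset.sum_congr rfl fun r _ => ?_
      rw [hprdep x s s0 (Finset.mem_filter.1 hs).2]; ring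
    have h2 : ∀ s ∈ Finset.univ.filter (fun s => φ s = φ s0),
        pi0 x s * ∑ r ∈ R, pr x s r * (wz x (φ s) * r) ^ 2
          = pi0 x s * (wz x (φ s0) ^ 2 * m2 x s0) := by
      intro s hs
      rw [hm2, Finset.mul_sum _ _ (wz x (φ s0) ^ 2)]
      congr 1
      refine Finset.sum_congr rfl fun r _ => ?_
      rw [hprdep x s s0 (Finset.mem_filter.1 hs).2, (Finset.mem_filter.1 hs).2]; ring
    have hc : ∀ g : S → ℝ, ∑ s, cond x (φ s0) s * g s
        = (∑ s ∈ Finset.univ.filter (fun s => φ s = φ s0), pi0 x s * g s)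
          / marg pi0 x (φ s0) := by
      intro g
      rw [Finset.sum_div, Finset.sum_filter]
      refine Finset.sum_congr rfl fun s _ => ?_
      rw [hcond]
      split_ifs
      · ring
      · ring
    rw [Finset.sum_congr rfl h1, Finset.sum_congr rfl h2, ← Finset.sum_mul, ← Finset.sum_mul,
      hc, hc, Finset.sum_congr rfl (fun s _ => hpw x s), ← hmarg, ← hmarg, hwz, hm2z]
    field_simp
  simp_rw [hmean, ← hsec, mul_sub, Finset.sum_sub_distrib]
  ring
end

section
/- The difference of expected squared statistics between IPS and LIPS decomposes as: ∑_x p(x) ∑_s π₀(s|x) ∑_z p_θ(z|x,s) · (w(x,s)² − w_θ(x,z)²) · m₂(x,s) = ∑_x p(x) ∑_{z : p_θ(z|x;π₀)>0} p_θ(z|x;π₀) · [ Var_{p_θ(·|x,z;π₀)}[w(x,·)] · E_{p_θ(·|x,z;π₀)}[m₂(x,·)] + Cov_{p_θ(·|x,z;π₀)}( w(x,·)², m₂(x,·) ) ], where for a probability mass function μ on S we write E_μ[f] := ∑_s μ(s) f(s), Var_μ[f] := E_μ[f²] − (E_μ[f])², and Cov_μ(f,g) := E_μ[f·g] − E_μ[f]·E_μ[g].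 -/
/-- Decomposition of the difference of expected squared statistics between IPS and
LIPS into a variance term and a covariance term under the posterior
`p_θ(·|x,z;π₀)`:
`∑_x p(x) ∑_s π₀(s|x) ∑_z p_θ(z|x,s) (w(x,s)² − w_θ(x,z)²) m₂(x,s)
 = ∑_x p(x) ∑_{z : p_θ(z|x;π₀)>0} p_θ(z|x;π₀)
     [ Var[w(x,·)] · E[m₂(x,·)] + Cov(w(x,·)², m₂(x,·)) ]`. -/
theorem lips_second_moment_decomposition
    {X S Z : Type*} [Fintype X] [Fintype S] [Fintype Z] [Nonempty X] [Nonempty S]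
    (p : X → ℝ) (hp0 : ∀ x, 0 ≤ p x) (hp1 : ∑ x, p x = 1)
    (pi pi0 : X → S → ℝ)
    (hpi0 : ∀ x s, 0 ≤ pi x s) (hpi1 : ∀ x, ∑ s, pi x s = 1)
    (hpi0pos : ∀ x s, 0 < pi0 x s) (hpi01 : ∀ x, ∑ s, pi0 x s = 1)
    (R : Finset ℝ) (pr : X → S → ℝ → ℝ)
    (hpr0 : ∀ x s, ∀ r ∈ R, 0 ≤ pr x s r) (hpr1 : ∀ x s, ∑ r ∈ R, pr x s r = 1)
    (m2 : X → S → ℝ) (hm2 : ∀ x s, m2 x s = ∑ r ∈ R, pr x s r * r ^ 2)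
    (ptheta : X → S → Z → ℝ)
    (hpt0 : ∀ x s z, 0 ≤ ptheta x s z) (hpt1 : ∀ x s, ∑ z, ptheta x s z = 1)
    (w : X → S → ℝ) (hw : ∀ x s, w x s = pi x s / pi0 x s)
    (marg : (X → S → ℝ) → X → Z → ℝ)
    (hmarg : ∀ mu x z, marg mu x z = ∑ s, mu x s * ptheta x s z)
    (wtheta : X → Z → ℝ) (hwtheta : ∀ x z, wtheta x z = marg pi x z / marg pi0 x z)
    (post : X → Z → S → ℝ)
    (hpost : ∀ x z s, post x z s = pi0 x s * ptheta x s z / marg pi0 x z) :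
    ∑ x, p x * ∑ s, pi0 x s * ∑ z, ptheta x s z * ((w x s ^ 2 - wtheta x z ^ 2) * m2 x s)
      = ∑ x, p x * ∑ z ∈ Finset.univ.filter (fun z => 0 < marg pi0 x z),
          marg pi0 x z *
            (((∑ s, post x z s * w x s ^ 2) - (∑ s, post x z s * w x s) ^ 2) *
                (∑ s, post x z s * m2 x s) +
              ((∑ s, post x z s * (w x s ^ 2 * m2 x s)) -
                (∑ s, post x z s * w x s ^ 2) * (∑ s, post x z s * m2 x s))) := by
  refine Finset.sum_congr rfl fun x _ => ?_
  congr 1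
  conv_lhs => simp only [Finset.mul_sum]
  rw [Finset.sum_comm, Finset.sum_filter]
  refine Finset.sum_congr rfl fun z _ => ?_
  have hnn : ∀ s ∈ Finset.univ, 0 ≤ pi0 x s * ptheta x s z := fun s _ =>
    mul_nonneg (hpi0pos x s).le (hpt0 x s z)
  split_ifs with hz
  · have hne := hz.ne'
    have hE : ∑ s, post x z s * w x s = wtheta x z := by
      rw [hwtheta, hmarg pi, Finset.sum_div]
      refine Finset.sum_congr rfl fun s _ => ?_
      have := (hpi0pos x s).ne'
      rw [hpost, hw]
      field_simp
    have key : ∀ f : S → ℝ, marg pi0 x z * ∑ s, post x z s * f s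
        = ∑ s, pi0 x s * ptheta x s z * f s := by
      intro f
      rw [Finset.mul_sum]
      refine Finset.sum_congr rfl fun s _ => ?_
      rw [hpost]
      field_simp
    have h1 := key (fun s => w x s ^ 2 * m2 x s)
    have h2 := key (fun s => m2 x s)
    rw [hE]
    have h3 : ∑ s, pi0 x s * (ptheta x s z * ((w x s ^ 2 - wtheta x z ^ 2) * m2 x s))
        = ∑ s, pi0 x s * ptheta x s z * (w x s ^ 2 * m2 x s)
          - wtheta x z ^ 2 * ∑ s, pi0 x s * ptheta x s z * m2 x s := by
      rw [Finset.mul_sum, ← Finset.sum_sub_distrib]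
      refine Finset.sum_congr rfl fun s _ => ?_
      ring
    rw [h3, ← h1, ← h2]
    ring
  · have h0 : ∑ s, pi0 x s * ptheta x s z = 0 := by
      rw [← hmarg]
      refine le_antisymm (not_lt.mp hz) ?_
      rw [hmarg]
      exact Finset.sum_nonneg hnn
    rw [Finset.sum_eq_zero_iff_of_nonneg hnn] at h0
    refine Finset.sum_eq_zero fun s hs => ?_
    rw [← mul_assoc, h0 s hs, zero_mul]
end

section
/- Let D = {(x_i, s_i, z_i, r_i)}_{i=1}^n be i.i.d. draws from p(x) π₀(s|x) p_θ(z|x,s) p_r(r|x,s), and define the n-sample estimators IPS_n := (1/n) ∑_i w(x_i,s_i) r_i and LIPS_n := (1/n) ∑_i w_θ(x_i,z_i) r_i, with MSE(V̂) := E_D[(V̂ − V(π))²]. Then n·( MSE(IPS_n) − MSE(LIPS_n) ) = ∑_x p(x) ∑_{z : p_θ(z|x;π₀)>0} p_θ(z|x;π₀) · Var_{p_θ(·|x,z;π₀)}[w(x,·)] · E_{p_θ(·|x,z;π₀)}[m₂(x,·)] + ∑_x p(x) ∑_{z : p_θ(z|x;π₀)>0} p_θ(z|x;π₀) · Cov_{p_θ(·|x,z;π₀)}(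 w(x,·)², m₂(x,·) ) + 2·V(π)·Bias + (1 − n)·Bias², where Bias is the bias of LIPS, and for a probability mass function μ on S, E_μ[f] := ∑_s μ(s) f(s), Var_μ[f] := E_μ[f²] − (E_μ[f])², Cov_μ(f,g) := E_μ[f·g] − E_μ[f]·E_μ[g]. -/
theorem lips_aux_sum {T : Type*} [Fintype T] (P f : T → ℝ) (h1 : ∑ a, P a = 1) (n : ℕ) :
    ∀ c : ℝ, ∑ D : Fin n → T, (∏ i, P (D i)) * ((∑ i, f (D i)) - c) ^ 2
      = n * ((∑ a, P a * f a ^ 2) - (∑ a, P a * f a) ^ 2) + (n * (∑ a, P a * f a) - c) ^ 2 := by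
  induction n with
  | zero => intro c; simp
  | succ n ih =>
    intro c
    rw [← (Fin.consEquiv (fun _ : Fin (n + 1) => T)).sum_comp, Fintype.sum_prod_type]
    have h : ∀ a : T, ∑ D : Fin n → T,
        (∏ i, P ((Fin.consEquiv (fun _ : Fin (n + 1) => T)) (a, D) i)) *
          ((∑ i, f ((Fin.consEquiv (fun _ : Fin (n + 1) => T)) (a, D) i)) - c) ^ 2
        = P a * (n * ((∑ a, P a * f a ^ 2) - (∑ a, P a * f a) ^ 2) +
            (n * (∑ a, P a * f a) - (c - f a)) ^ 2) := by
      intro a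
      rw [← ih (c - f a), Finset.mul_sum]
      refine Finset.sum_congr rfl fun D _ => ?_
      simp only [Fin.consEquiv, Equiv.coe_fn_mk, Fin.prod_univ_succ, Fin.sum_univ_succ,
        Fin.cons_zero, Fin.cons_succ]
      ring
    rw [Finset.sum_congr rfl fun a _ => h a]
    generalize hM : ∑ a, P a * f a = M
    generalize hQ : ∑ a, P a * f a ^ 2 = Q
    have : ∀ a, P a * (n * (Q - M ^ 2) + (n * M - (c - f a)) ^ 2)
        = P a * (n * (Q - M ^ 2) + (n * M - c) ^ 2) + P a * f a * (2 * (n * M - c))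
          + P a * f a ^ 2 := fun a => by ring
    simp only [this, Finset.sum_add_distrib, ← Finset.sum_mul, h1, hM, hQ]
    push_cast
    ring

theorem lips_aux_mse {T : Type*} [Fintype T] (P f : T → ℝ) (h1 : ∑ a, P a = 1) (n : ℕ)
    (hn : 0 < n) (V : ℝ) :
    (n : ℝ) * ∑ D : Fin n → T, (∏ i, P (D i)) * ((n : ℝ)⁻¹ * (∑ i, f (D i)) - V) ^ 2
      = (∑ a, P a * f a ^ 2) - (∑ a, P a * f a) ^ 2 + n * ((∑ a, P a * f a) - V) ^ 2 := by
  have hn' : (n : ℝ) ≠ 0 := by positivity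
  have h := lips_aux_sum P f h1 n (n * V)
  have : ∑ D : Fin n → T, (∏ i, P (D i)) * ((n : ℝ)⁻¹ * (∑ i, f (D i)) - V) ^ 2
      = ((n : ℝ)⁻¹) ^ 2 *
        ∑ D : Fin n → T, (∏ i, P (D i)) * ((∑ i, f (D i)) - n * V) ^ 2 := by
    rw [Finset.mul_sum]
    refine Finset.sum_congr rfl fun D _ => ?_
    field_simp
  rw [this, h]
  field_simp

theorem lips_aux_four {X S Z Θ : Type*} [Fintype X] [Fintype S] [Fintype Z] [Fintype Θ]
    (p : X → ℝ) (pi0 : X → S → ℝ) (ptheta : X → S → Z → ℝ) (pr : X → S → Θ → ℝ)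
    (g : X → S → Z → ℝ) (h : Θ → ℝ) :
    ∑ a : X × S × Z × Θ, (p a.1 * pi0 a.1 a.2.1 * ptheta a.1 a.2.1 a.2.2.1 *
        pr a.1 a.2.1 a.2.2.2) * (g a.1 a.2.1 a.2.2.1 * h a.2.2.2)
      = ∑ x, p x * ∑ s, pi0 x s * ∑ z, ptheta x s z * (g x s z * ∑ t, pr x s t * h t) := by
  simp only [Fintype.sum_prod_type, Finset.mul_sum]
  refine Finset.sum_congr rfl fun x _ => Finset.sum_congr rfl fun s _ =>
    Finset.sum_congr rfl fun z _ => Finset.sum_congr rfl fun t _ => ?_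
  ring


/-- The gain in MSE of LIPS over IPS with a stochastic slate abstraction:
for `n` i.i.d. samples `(x_i, s_i, z_i, r_i) ∼ p(x) π₀(s|x) p_θ(z|x,s) p_r(r|x,s)`,
`n (MSE(IPS_n) − MSE(LIPS_n))
  = ∑_x p(x) ∑_z p_θ(z|x;π₀) Var[w] E[m₂] + ∑_x p(x) ∑_z p_θ(z|x;π₀) Cov(w², m₂)
    + 2 V(π) Bias + (1 − n) Bias²`.
Rewards take finitely many values: they are indexed by a finite type `Θ` with
value map `rv : Θ → ℝ` and conditional pmf `pr x s : Θ → ℝ`. -/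
theorem lips_mse_gain
    {X S Z Θ : Type*} [Fintype X] [Fintype S] [Fintype Z] [Fintype Θ]
    [Nonempty X] [Nonempty S] [Nonempty Θ]
    (p : X → ℝ) (hp0 : ∀ x, 0 ≤ p x) (hp1 : ∑ x, p x = 1)
    (pi pi0 : X → S → ℝ)
    (hpi0 : ∀ x s, 0 ≤ pi x s) (hpi1 : ∀ x, ∑ s, pi x s = 1)
    (hpi0pos : ∀ x s, 0 < pi0 x s) (hpi01 : ∀ x, ∑ s, pi0 x s = 1)
    (rv : Θ → ℝ) (pr : X → S → Θ → ℝ)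
    (hpr0 : ∀ x s t, 0 ≤ pr x s t) (hpr1 : ∀ x s, ∑ t, pr x s t = 1)
    (q : X → S → ℝ) (hq : ∀ x s, q x s = ∑ t, pr x s t * rv t)
    (m2 : X → S → ℝ) (hm2 : ∀ x s, m2 x s = ∑ t, pr x s t * rv t ^ 2)
    (ptheta : X → S → Z → ℝ)
    (hpt0 : ∀ x s z, 0 ≤ ptheta x s z) (hpt1 : ∀ x s, ∑ z, ptheta x s z = 1)
    (w : X → S → ℝ) (hw : ∀ x s, w x s = pi x s / pi0 x s)
    (marg : (X → S → ℝ) → X → Z → ℝ)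
    (hmarg : ∀ mu x z, marg mu x z = ∑ s, mu x s * ptheta x s z)
    (wtheta : X → Z → ℝ) (hwtheta : ∀ x z, wtheta x z = marg pi x z / marg pi0 x z)
    (post : X → Z → S → ℝ)
    (hpost : ∀ x z s, post x z s = pi0 x s * ptheta x s z / marg pi0 x z)
    (V Bias : ℝ)
    (hV : V = ∑ x, p x * ∑ s, pi x s * q x s)
    (hBias : Bias =
      (∑ x, p x * ∑ s, pi0 x s * ∑ z, ptheta x s z * (wtheta x z * q x s)) - V)
    (n : ℕ) (hn : 0 < n)
    (MSEI MSEL : ℝ)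
    -- MSE of the n-sample IPS estimator, the expectation taken over the i.i.d.
    -- logged data `D : Fin n → X × S × Z × Θ`
    (hMSEI : MSEI = ∑ D : Fin n → X × S × Z × Θ,
      (∏ i, p (D i).1 * pi0 (D i).1 (D i).2.1 * ptheta (D i).1 (D i).2.1 (D i).2.2.1 *
        pr (D i).1 (D i).2.1 (D i).2.2.2) *
      ((n : ℝ)⁻¹ * (∑ i, w (D i).1 (D i).2.1 * rv (D i).2.2.2) - V) ^ 2)
    -- MSE of the n-sample LIPS estimator
    (hMSEL : MSEL = ∑ D : Fin n → X × S × Z × Θ,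
      (∏ i, p (D i).1 * pi0 (D i).1 (D i).2.1 * ptheta (D i).1 (D i).2.1 (D i).2.2.1 *
        pr (D i).1 (D i).2.1 (D i).2.2.2) *
      ((n : ℝ)⁻¹ * (∑ i, wtheta (D i).1 (D i).2.2.1 * rv (D i).2.2.2) - V) ^ 2) :
    (n : ℝ) * (MSEI - MSEL)
      = (∑ x, p x * ∑ z ∈ Finset.univ.filter (fun z => 0 < marg pi0 x z),
            marg pi0 x z *
              (((∑ s, post x z s * w x s ^ 2) - (∑ s, post x z s * w x s) ^ 2) *
                (∑ s, post x z s * m2 x s)))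
        + (∑ x, p x * ∑ z ∈ Finset.univ.filter (fun z => 0 < marg pi0 x z),
            marg pi0 x z *
              ((∑ s, post x z s * (w x s ^ 2 * m2 x s)) -
                (∑ s, post x z s * w x s ^ 2) * (∑ s, post x z s * m2 x s)))
        + 2 * V * Bias + (1 - (n : ℝ)) * Bias ^ 2 := by
  have hP1 : ∑ a : X × S × Z × Θ, (p a.1 * pi0 a.1 a.2.1 * ptheta a.1 a.2.1 a.2.2.1 *
        pr a.1 a.2.1 a.2.2.2) = 1 := by
    have := lips_aux_four p pi0 ptheta pr (fun _ _ _ => 1) (fun _ => 1)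
    simpa [hpr1, hpt1, hpi01, hp1] using this
  have hI := lips_aux_mse _ (fun a : X × S × Z × Θ => w a.1 a.2.1 * rv a.2.2.2) hP1 n hn V
  have hL := lips_aux_mse _ (fun a : X × S × Z × Θ => wtheta a.1 a.2.2.1 * rv a.2.2.2) hP1 n hn V
  have e1 := lips_aux_four p pi0 ptheta pr (fun x s _ => w x s) rv
  have e2 := lips_aux_four p pi0 ptheta pr (fun x s _ => w x s ^ 2) (fun t => rv t ^ 2)
  have e3 := lips_aux_four p pi0 ptheta pr (fun x _ z => wtheta x z) rv
  have e4 := lips_aux_four p pi0 ptheta pr (fun x _ z => wtheta x z ^ 2) (fun t => rv t ^ 2)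
  simp only [← hq, ← hm2] at e1 e2 e3 e4
  simp only [mul_pow] at hI hL
  rw [← hMSEI, e1, e2] at hI
  rw [← hMSEL, e3, e4] at hL
  have hpw : ∀ x s, pi0 x s * w x s = pi x s := fun x s => by
    rw [hw, mul_div_cancel₀ _ (hpi0pos x s).ne']
  have v1 : ∑ x, p x * ∑ s, pi0 x s * ∑ z, ptheta x s z * (w x s * q x s) = V := by
    rw [hV]
    refine Finset.sum_congr rfl fun x _ => ?_
    congr 1
    refine Finset.sum_congr rfl fun s _ => ?_
    rw [← Finset.sum_mul, hpt1, one_mul, ← mul_assoc, hpw]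
  have v3 : ∑ x, p x * ∑ s, pi0 x s * ∑ z, ptheta x s z * (wtheta x z * q x s) = V + Bias := by
    rw [hBias]; ring
  rw [v1] at hI
  rw [v3] at hL
  have key : ∀ x, (∑ z ∈ Finset.univ.filter (fun z => 0 < marg pi0 x z),
            marg pi0 x z *
              (((∑ s, post x z s * w x s ^ 2) - (∑ s, post x z s * w x s) ^ 2) *
                (∑ s, post x z s * m2 x s)))
        + (∑ z ∈ Finset.univ.filter (fun z => 0 < marg pi0 x z),
            marg pi0 x z *
              ((∑ s, post x z s * (w x s ^ 2 * m2 x s)) -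
                (∑ s, post x z s * w x s ^ 2) * (∑ s, post x z s * m2 x s)))
      = (∑ s, pi0 x s * ∑ z, ptheta x s z * (w x s ^ 2 * m2 x s))
        - ∑ s, pi0 x s * ∑ z, ptheta x s z * (wtheta x z ^ 2 * m2 x s) := by
    intro x
    simp only [Finset.mul_sum (s := (Finset.univ : Finset Z))]
    rw [← Finset.sum_add_distrib, Finset.sum_comm (s := (Finset.univ : Finset S)),
      Finset.sum_comm (s := (Finset.univ : Finset S)), ← Finset.sum_sub_distrib,
      Finset.sum_filter]
    refine Finset.sum_congr rfl fun z _ => ?_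
    have hnn : ∀ s, 0 ≤ pi0 x s * ptheta x s z := fun s =>
      mul_nonneg (hpi0pos x s).le (hpt0 x s z)
    split_ifs with hz
    · have hps : ∀ g : S → ℝ, marg pi0 x z * ∑ s, post x z s * g s
          = ∑ s, pi0 x s * (ptheta x s z * g s) := by
        intro g
        rw [Finset.mul_sum]
        refine Finset.sum_congr rfl fun s _ => ?_
        rw [hpost]
        field_simp
      have hwt : ∑ s, post x z s * w x s = wtheta x z := by
        have h := hps (w x)
        have h2 : ∑ s, pi0 x s * (ptheta x s z * w x s) = marg pi x z := by
          rw [hmarg]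
          refine Finset.sum_congr rfl fun s _ => ?_
          rw [← hpw]; ring
        rw [hwtheta, ← h2, ← h, mul_div_cancel_left₀ _ hz.ne']
      rw [← hps (fun s => w x s ^ 2 * m2 x s)]
      have h5 := hps (fun s => wtheta x z ^ 2 * m2 x s)
      have h6 : ∑ s, post x z s * (wtheta x z ^ 2 * m2 x s)
          = wtheta x z ^ 2 * ∑ s, post x z s * m2 x s := by
        rw [Finset.mul_sum]
        exact Finset.sum_congr rfl fun s _ => by ring
      rw [← h5, h6, hwt]
      ring
    · have h0 : ∑ s, pi0 x s * ptheta x s z = 0 := by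
        have := Finset.sum_nonneg (fun s (_ : s ∈ Finset.univ) => hnn s)
        rw [hmarg] at hz
        linarith
      have h0' := (Finset.sum_eq_zero_iff_of_nonneg (fun s _ => hnn s)).1 h0
      simp only [Finset.mem_univ, forall_const] at h0'
      simp only [← mul_assoc, h0', zero_mul, Finset.sum_const_zero, sub_zero]
  rw [← Finset.sum_add_distrib]
  rw [Finset.sum_congr rfl fun x _ => ((mul_add _ _ _).symm.trans
    ((congrArg (fun y => p x * y) (key x)).trans (mul_sub _ _ _))), Finset.sum_sub_distrib, mul_sub]
  rw [hI, hL]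
  ring
end

section
/- Assume the reward function is linearly decomposable (the linearity assumption): there exist functions φ_l : X × A_l → ℝ such that q(x,s) = ∑_{l=1}^L φ_l(x, a_l) for every context x and slate s = (a_1,…,a_L). Then the PseudoInverse estimator is unbiased: ∑_x p(x) ∑_s π₀(s|x) · ( ∑_{l=1}^L π_l(a_l|x)/π₀_l(a_l|x) − L + 1 ) · q(x,s) = V(π). -/
theorem aux_prod_update {L : ℕ} {A : Fin L → Type*} (g : (l : Fin L) → A l → ℝ) (k : Fin L)
    (w : A k → ℝ) (s : ∀ l, A l) :
    ∏ l, (Function.update g k (fun a => g k a * w a)) l (s l) = (∏ l, g l (s l)) * w (s k) := by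
  rw [← Finset.mul_prod_erase Finset.univ (fun l => g l (s l)) (Finset.mem_univ k),
    ← Finset.mul_prod_erase Finset.univ _ (Finset.mem_univ k)]
  have : ∏ l ∈ Finset.univ.erase k, (Function.update g k (fun a => g k a * w a)) l (s l)
      = ∏ l ∈ Finset.univ.erase k, g l (s l) := by
    refine Finset.prod_congr rfl fun l hl => ?_
    rw [Function.update_of_ne (Finset.ne_of_mem_erase hl)]
  rw [this, Function.update_self]
  ring

theorem aux_marginal {L : ℕ} {A : Fin L → Type*} [∀ l, Fintype (A l)]
    (g : (l : Fin L) → A l → ℝ) (hg : ∀ l, ∑ a, g l a = 1) (k : Fin L) (w : A k → ℝ) :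
    ∑ s : (∀ l, A l), (∏ l, g l (s l)) * w (s k) = ∑ a, g k a * w a := by
  simp_rw [← aux_prod_update g k w]
  rw [← Fintype.piFinset_univ, ← Finset.prod_univ_sum,
    ← Finset.mul_prod_erase Finset.univ _ (Finset.mem_univ k), Function.update_self,
    Finset.prod_eq_one, mul_one]
  intro l hl
  rw [Function.update_of_ne (Finset.ne_of_mem_erase hl)]
  exact hg l

theorem aux_cross {L : ℕ} {A : Fin L → Type*} [∀ l, Fintype (A l)]
    (g h : (l : Fin L) → A l → ℝ) (hpos : ∀ l a, 0 < g l a) (hg : ∀ l, ∑ a, g l a = 1)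
    (hh : ∀ l, ∑ a, h l a = 1) (k m : Fin L) (w : A m → ℝ) :
    ∑ s : (∀ l, A l), (∏ l, g l (s l)) * (h k (s k) / g k (s k)) * w (s m)
      = (∑ a, g m a * w a) + if k = m then (∑ a, h m a * w a) - ∑ a, g m a * w a else 0 := by
  have e : (fun a => g k a * (h k a / g k a)) = h k := by
    funext a
    have := (hpos k a).ne'
    field_simp
  have e2 : ∀ s : (∀ l, A l), (∏ l, g l (s l)) * (h k (s k) / g k (s k))
      = ∏ l, (Function.update g k (h k)) l (s l) := by
    intro s
    have := aux_prod_update g k (fun a => h k a / g k a) s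
    rw [e] at this
    exact this.symm
  simp_rw [e2]
  rw [aux_marginal]
  · split_ifs with hkm
    · subst hkm
      rw [Function.update_self]; ring
    · rw [Function.update_of_ne (Ne.symm hkm)]; ring
  · intro l
    by_cases hl : l = k
    · subst hl
      rw [Function.update_self]; exact hh l
    · rw [Function.update_of_ne hl]; exact hg l

/-- Unbiasedness of the PseudoInverse (PI) estimator under the linearity
assumption: if the expected reward decomposes as `q x s = ∑ l, φl l x (s l)`,
then `∑_x p(x) ∑_s π₀(s|x) (∑_l π_l(a_l|x)/π₀_l(a_l|x) − L + 1) q(x,s) = V(π)`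
for factored target and logging policies. -/
theorem pi_estimator_unbiased_linear
    {X : Type*} [Fintype X] [Nonempty X]
    (L : ℕ) (hL : 0 < L)
    (A : Fin L → Type*) [∀ l, Fintype (A l)] [∀ l, Nonempty (A l)]
    (p : X → ℝ) (hp0 : ∀ x, 0 ≤ p x) (hp1 : ∑ x, p x = 1)
    (pil pi0l : (l : Fin L) → X → A l → ℝ)
    (hpil0 : ∀ l x a, 0 ≤ pil l x a) (hpil1 : ∀ l x, ∑ a, pil l x a = 1)
    (hpi0lpos : ∀ l x a, 0 < pi0l l x a) (hpi0l1 : ∀ l x, ∑ a, pi0l l x a = 1)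
    (q : X → (∀ l, A l) → ℝ)
    (φl : (l : Fin L) → X → A l → ℝ)
    (hlin : ∀ x (s : ∀ l, A l), q x s = ∑ l, φl l x (s l)) :
    ∑ x, p x * ∑ s : (∀ l, A l), (∏ l, pi0l l x (s l)) *
        (((∑ l, pil l x (s l) / pi0l l x (s l)) - (L : ℝ) + 1) * q x s)
      = ∑ x, p x * ∑ s : (∀ l, A l), (∏ l, pil l x (s l)) * q x s := by
  refine Finset.sum_congr rfl fun x _ => ?_
  congr 1
  have hR : ∑ s : (∀ l, A l), (∏ l, pil l x (s l)) * q x s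
      = ∑ m, ∑ a, pil m x a * φl m x a := by
    simp_rw [hlin, Finset.mul_sum]
    rw [Finset.sum_comm]
    exact Finset.sum_congr rfl fun m _ =>
      aux_marginal (fun l => pil l x) (fun l => hpil1 l x) m (φl m x)
  rw [hR]
  have hS : ∀ s : (∀ l, A l), (∏ l, pi0l l x (s l)) *
        (((∑ l, pil l x (s l) / pi0l l x (s l)) - (L : ℝ) + 1) * q x s)
      = ∑ m, ((∑ k, (∏ l, pi0l l x (s l)) * (pil k x (s k) / pi0l k x (s k)) * φl m x (s m))
        - ((L : ℝ) - 1) * ((∏ l, pi0l l x (s l)) * φl m x (s m))) := by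
    intro s
    simp_rw [Finset.sum_sub_distrib, ← Finset.sum_mul, ← Finset.mul_sum]
    rw [hlin]
    ring
  simp_rw [hS]
  rw [Finset.sum_comm]
  refine Finset.sum_congr rfl fun m _ => ?_
  rw [Finset.sum_sub_distrib, Finset.sum_comm, ← Finset.mul_sum,
    aux_marginal (fun l => pi0l l x) (fun l => hpi0l1 l x) m (φl m x),
    Finset.sum_congr rfl fun k _ => aux_cross (fun l => pi0l l x) (fun l => pil l x)
      (fun l => hpi0lpos l x) (fun l => hpi0l1 l x) (fun l => hpil1 l x) k m (φl m x),
    Finset.sum_add_distrib]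
  simp
  ring
end

section
/- Fix k with 1 ≤ k ≤ L and assume the expected reward depends only on the first k sub-actions: q(x,s) = q(x,s') whenever the slates s and s' agree in slots 1,…,k. Then the MIPS-style estimator that importance-weights only the first k slots is unbiased: ∑_x p(x) ∑_s π₀(s|x) · ( ∏_{l=1}^k π_l(a_l|x)/π₀_l(a_l|x) ) · q(x,s) = V(π). -/
theorem marg_aux {ι : Type*} [Fintype ι] [DecidableEq ι] (A : ι → Type*) [∀ l, Fintype (A l)]
    [∀ l, Nonempty (A l)] (P : ι → Prop) [DecidablePred P] (w : ∀ l, A l → ℝ)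
    (hw : ∀ l, ∑ a, w l a = 1) (f : (∀ l, A l) → ℝ)
    (hf : ∀ s s' : ∀ l, A l, (∀ l, P l → s l = s' l) → f s = f s') :
    ∑ s, (∏ l, w l (s l)) * f s =
      ∑ t : (∀ i : {l // P l}, A i), (∏ i : {l // P l}, w i.1 (t i)) *
        f ((Equiv.piEquivPiSubtypeProd P A).symm (t, fun _ => Classical.arbitrary _)) := by
  rw [← (Equiv.piEquivPiSubtypeProd P A).symm.sum_comp, Fintype.sum_prod_type]
  refine Finset.sum_congr rfl fun t _ => ?_
  have h1 : ∀ u : (∀ i : {l // ¬ P l}, A i),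
      (∏ l, w l ((Equiv.piEquivPiSubtypeProd P A).symm (t, u) l)) *
        f ((Equiv.piEquivPiSubtypeProd P A).symm (t, u)) =
      ((∏ i : {l // P l}, w i.1 (t i)) *
        f ((Equiv.piEquivPiSubtypeProd P A).symm (t, fun _ => Classical.arbitrary _))) *
        ∏ i : {l // ¬ P l}, w i.1 (u i) := by
    intro u
    rw [hf _ ((Equiv.piEquivPiSubtypeProd P A).symm (t, fun _ => Classical.arbitrary _))
      (fun l hl => by simp [Equiv.piEquivPiSubtypeProd, hl]),
      ← Fintype.prod_subtype_mul_prod_subtype P]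
    have e1 : ∀ i : {l // P l}, (Equiv.piEquivPiSubtypeProd P A).symm (t, u) i = t i := by
      intro i; simp [Equiv.piEquivPiSubtypeProd, i.2]
    have e2 : ∀ i : {l // ¬ P l}, (Equiv.piEquivPiSubtypeProd P A).symm (t, u) i = u i := by
      intro i; simp [Equiv.piEquivPiSubtypeProd, i.2]
    simp only [e1, e2]
    ring
  rw [Finset.sum_congr rfl fun u _ => h1 u, ← Finset.mul_sum]
  have h2 := (Fintype.prod_sum (fun (i : {l // ¬ P l}) (a : A i) => w i.1 a)).symm
  rw [h2]
  simp [hw]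

/-- Unbiasedness of the MIPS-style estimator that importance-weights only the
first `k` slots, when the expected reward depends only on the first `k`
sub-actions:
`∑_x p(x) ∑_s π₀(s|x) (∏_{l<k} π_l(a_l|x)/π₀_l(a_l|x)) q(x,s) = V(π)`. -/
theorem mips_first_k_unbiased
    {X : Type*} [Fintype X] [Nonempty X]
    (L : ℕ) (hL : 0 < L)
    (A : Fin L → Type*) [∀ l, Fintype (A l)] [∀ l, Nonempty (A l)]
    (p : X → ℝ) (hp0 : ∀ x, 0 ≤ p x) (hp1 : ∑ x, p x = 1)
    (pil pi0l : (l : Fin L) → X → A l → ℝ)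
    (hpil0 : ∀ l x a, 0 ≤ pil l x a) (hpil1 : ∀ l x, ∑ a, pil l x a = 1)
    (hpi0lpos : ∀ l x a, 0 < pi0l l x a) (hpi0l1 : ∀ l x, ∑ a, pi0l l x a = 1)
    (q : X → (∀ l, A l) → ℝ)
    (k : ℕ) (hk1 : 1 ≤ k) (hkL : k ≤ L)
    -- q depends only on the first k sub-actions
    (hdep : ∀ x (s s' : ∀ l, A l), (∀ l : Fin L, (l : ℕ) < k → s l = s' l) →
      q x s = q x s') :
    ∑ x, p x * ∑ s : (∀ l, A l), (∏ l, pi0l l x (s l)) *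
        ((∏ l ∈ Finset.univ.filter (fun l : Fin L => (l : ℕ) < k),
            pil l x (s l) / pi0l l x (s l)) * q x s)
      = ∑ x, p x * ∑ s : (∀ l, A l), (∏ l, pil l x (s l)) * q x s := by
  refine Finset.sum_congr rfl fun x _ => ?_
  congr 1
  rw [marg_aux A (fun l => (l : ℕ) < k) (fun l => pil l x) (fun l => hpil1 l x) (q x) (hdep x)]
  have h := marg_aux A (fun l => (l : ℕ) < k)
    (fun l a => if (l : ℕ) < k then pil l x a else pi0l l x a)
    (fun l => by split_ifs <;> simp [hpil1, hpi0l1]) (q x) (hdep x)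
  refine Eq.trans (Finset.sum_congr rfl fun s _ => ?_) (h.trans ?_)
  · rw [← mul_assoc, Finset.prod_filter, ← Finset.prod_mul_distrib]
    congr 1
    refine Finset.prod_congr rfl fun l _ => ?_
    have := (hpi0lpos l x (s l)).ne'
    split_ifs
    · field_simp
    · simp
  · refine Finset.sum_congr rfl fun t _ => ?_
    congr 1
    exact Finset.prod_congr rfl fun i _ => if_pos i.2
end

section
/- Assume the conditional second moment of the reward depends only on the context and the abstraction: m₂(x,s) = m₂(x,s') whenever φ(s) = φ(s'). Then the difference of expected squared statistics equals the expected squared deviation of the weights: ∑_x p(x) ∑_s π₀(s|x) ( w(x,s)² − w(x,φ(s))² ) m₂(x,s) = ∑_x p(x) ∑_s π₀(s|x) ( w(x,s) − w(x,φ(s)) )² m₂(x,s), where w(x,z) := π(z|x)/π₀(z|x). -/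
/-- If the conditional second moment of the reward depends only on the context
and the abstraction (`m₂(x,s) = m₂(x,s')` whenever `φ s = φ s'`), then the
difference of expected squared statistics equals the expected squared deviation
of the weights:
`∑_x p(x) ∑_s π₀(s|x) (w(x,s)² − w(x,φ(s))²) m₂(x,s)
 = ∑_x p(x) ∑_s π₀(s|x) (w(x,s) − w(x,φ(s)))² m₂(x,s)`. -/
theorem lips_squared_weight_deviation
    {X S Z : Type*} [Fintype X] [Fintype S] [Fintype Z] [DecidableEq Z]
    [Nonempty X] [Nonempty S]
    (p : X → ℝ) (hp0 : ∀ x, 0 ≤ p x) (hp1 : ∑ x, p x = 1)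
    (pi pi0 : X → S → ℝ)
    (hpi0 : ∀ x s, 0 ≤ pi x s) (hpi1 : ∀ x, ∑ s, pi x s = 1)
    (hpi0pos : ∀ x s, 0 < pi0 x s) (hpi01 : ∀ x, ∑ s, pi0 x s = 1)
    (R : Finset ℝ) (pr : X → S → ℝ → ℝ)
    (hpr0 : ∀ x s, ∀ r ∈ R, 0 ≤ pr x s r) (hpr1 : ∀ x s, ∑ r ∈ R, pr x s r = 1)
    (m2 : X → S → ℝ) (hm2 : ∀ x s, m2 x s = ∑ r ∈ R, pr x s r * r ^ 2)
    (φ : S → Z)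
    (hm2dep : ∀ x s s', φ s = φ s' → m2 x s = m2 x s')
    (w : X → S → ℝ) (hw : ∀ x s, w x s = pi x s / pi0 x s)
    (marg : (X → S → ℝ) → X → Z → ℝ)
    (hmarg : ∀ mu x z, marg mu x z = ∑ s ∈ Finset.univ.filter (fun s => φ s = z), mu x s)
    (wz : X → Z → ℝ) (hwz : ∀ x z, wz x z = marg pi x z / marg pi0 x z) :
    ∑ x, p x * ∑ s, pi0 x s * ((w x s ^ 2 - wz x (φ s) ^ 2) * m2 x s)
      = ∑ x, p x * ∑ s, pi0 x s * ((w x s - wz x (φ s)) ^ 2 * m2 x s) := by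
  refine Finset.sum_congr rfl fun x _ => ?_
  congr 1
  have key : ∑ s, (pi x s - pi0 x s * wz x (φ s)) * (wz x (φ s) * m2 x s) = 0 := by
    rw [← Finset.sum_fiberwise Finset.univ φ]
    refine Finset.sum_eq_zero fun z _ => ?_
    rcases (Finset.univ.filter (fun s => φ s = z)).eq_empty_or_nonempty with h | ⟨s0, h0⟩
    · rw [h, Finset.sum_empty]
    · have hpos : 0 < marg pi0 x z := by
        rw [hmarg]
        exact Finset.sum_pos (fun s _ => hpi0pos x s) ⟨s0, h0⟩
      have hz : φ s0 = z := (Finset.mem_filter.mp h0).2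
      have e : ∀ s ∈ Finset.univ.filter (fun s => φ s = z),
          (pi x s - pi0 x s * wz x (φ s)) * (wz x (φ s) * m2 x s)
            = (pi x s - pi0 x s * wz x z) * (wz x z * m2 x s0) := by
        intro s hs
        have hs' : φ s = z := (Finset.mem_filter.mp hs).2
        rw [hm2dep x s s0 (hs'.trans hz.symm), hs']
      rw [Finset.sum_congr rfl e, ← Finset.sum_mul, Finset.sum_sub_distrib, ← Finset.sum_mul,
        ← hmarg, ← hmarg, hwz, mul_div_cancel₀ _ hpos.ne', sub_self, zero_mul]
  rw [← sub_eq_zero, ← Finset.sum_sub_distrib]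
  have e2 : ∀ s, pi0 x s * ((w x s ^ 2 - wz x (φ s) ^ 2) * m2 x s)
      - pi0 x s * ((w x s - wz x (φ s)) ^ 2 * m2 x s)
      = 2 * ((pi x s - pi0 x s * wz x (φ s)) * (wz x (φ s) * m2 x s)) := by
    intro s
    have h : pi x s = pi0 x s * w x s := by
      rw [hw, mul_div_cancel₀ _ (hpi0pos x s).ne']
    rw [h]
    ring
  rw [Finset.sum_congr rfl fun s _ => e2 s, ← Finset.mul_sum, key, mul_zero]
end

section
/- The bias of LIPS under a stochastic slate abstraction admits the representation: Bias = ∑_x p(x) ∑_{z : p_θ(z|x;π₀)>0} p_θ(z|x;π₀) · ∑_s p_θ(s|x,z;π₀) · w(x,s) · ( ∑_{s'} p_θ(s'|x,z;π₀) q(x,s') − q(x,s) ). -/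
/-- Representation of the bias of LIPS under a stochastic slate abstraction:
`Bias = ∑_x p(x) ∑_{z : p_θ(z|x;π₀)>0} p_θ(z|x;π₀)
          ∑_s p_θ(s|x,z;π₀) w(x,s) (∑_{s'} p_θ(s'|x,z;π₀) q(x,s') − q(x,s))`. -/
theorem lips_bias_representation
    {X S Z : Type*} [Fintype X] [Fintype S] [Fintype Z] [Nonempty X] [Nonempty S]
    (p : X → ℝ) (hp0 : ∀ x, 0 ≤ p x) (hp1 : ∑ x, p x = 1)
    (pi pi0 : X → S → ℝ)
    (hpi0 : ∀ x s, 0 ≤ pi x s) (hpi1 : ∀ x, ∑ s, pi x s = 1)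
    (hpi0pos : ∀ x s, 0 < pi0 x s) (hpi01 : ∀ x, ∑ s, pi0 x s = 1)
    (q : X → S → ℝ)
    (ptheta : X → S → Z → ℝ)
    (hpt0 : ∀ x s z, 0 ≤ ptheta x s z) (hpt1 : ∀ x s, ∑ z, ptheta x s z = 1)
    (w : X → S → ℝ) (hw : ∀ x s, w x s = pi x s / pi0 x s)
    (marg : (X → S → ℝ) → X → Z → ℝ)
    (hmarg : ∀ mu x z, marg mu x z = ∑ s, mu x s * ptheta x s z)
    (wtheta : X → Z → ℝ) (hwtheta : ∀ x z, wtheta x z = marg pi x z / marg pi0 x z)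
    (post : X → Z → S → ℝ)
    (hpost : ∀ x z s, post x z s = pi0 x s * ptheta x s z / marg pi0 x z)
    (V Bias : ℝ)
    (hV : V = ∑ x, p x * ∑ s, pi x s * q x s)
    (hBias : Bias =
      (∑ x, p x * ∑ s, pi0 x s * ∑ z, ptheta x s z * (wtheta x z * q x s)) - V) :
    Bias = ∑ x, p x * ∑ z ∈ Finset.univ.filter (fun z => 0 < marg pi0 x z),
      marg pi0 x z *
        ∑ s, post x z s * w x s * ((∑ s', post x z s' * q x s') - q x s) := by
  rw [hBias, hV, ← Finset.sum_sub_distrib]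
  refine Finset.sum_congr rfl fun x _ => ?_
  rw [← mul_sub]
  congr 1
  have h1 : ∑ s, pi0 x s * ∑ z, ptheta x s z * (wtheta x z * q x s)
      = ∑ z, wtheta x z * ∑ s, pi0 x s * ptheta x s z * q x s := by
    simp only [Finset.mul_sum]
    rw [Finset.sum_comm]
    refine Finset.sum_congr rfl fun z _ => Finset.sum_congr rfl fun s _ => ?_
    ring
  have h2 : ∑ s, pi x s * q x s = ∑ z, ∑ s, pi x s * ptheta x s z * q x s := by
    rw [Finset.sum_comm]
    refine Finset.sum_congr rfl fun s _ => ?_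
    rw [← Finset.sum_mul, ← Finset.mul_sum, hpt1, mul_one]
  rw [h1, h2, ← Finset.sum_sub_distrib, Finset.sum_filter]
  refine Finset.sum_congr rfl fun z _ => ?_
  split_ifs with hm
  · have hne := hm.ne'
    have hA : ∑ s', post x z s' * q x s'
        = (∑ s, pi0 x s * ptheta x s z * q x s) / marg pi0 x z := by
      rw [Finset.sum_div]
      refine Finset.sum_congr rfl fun s _ => ?_
      rw [hpost]; ring
    rw [hA, hwtheta, hmarg pi x z]
    generalize (∑ s, pi0 x s * ptheta x s z * q x s) = A
    rw [div_mul_eq_mul_div, mul_div_assoc, Finset.sum_mul, ← Finset.sum_sub_distrib,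
      Finset.mul_sum]
    refine Finset.sum_congr rfl fun s _ => ?_
    have := (hpi0pos x s).ne'
    rw [hpost, hw]
    field_simp
  · have hnn : ∀ s ∈ Finset.univ, 0 ≤ pi0 x s * ptheta x s z :=
      fun s _ => mul_nonneg (hpi0pos x s).le (hpt0 x s z)
    have h0 : ∑ s, pi0 x s * ptheta x s z = 0 := by
      rw [hmarg] at hm
      exact le_antisymm (not_lt.mp hm) (Finset.sum_nonneg hnn)
    have hz : ∀ s, ptheta x s z = 0 := fun s =>
      (mul_eq_zero.mp ((Finset.sum_eq_zero_iff_of_nonneg hnn).mp h0 s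
        (Finset.mem_univ s))).resolve_left (hpi0pos x s).ne'
    simp [hz]
end

section
/- Suppose the stochastic slate abstraction is sufficient in the sense that for every context x and every z with p_θ(z|x;π₀) > 0, the expected reward q(x,·) is constant on the set {s : p_θ(z|x,s) > 0}. Then LIPS is unbiased: ∑_x p(x) ∑_s π₀(s|x) ∑_z p_θ(z|x,s) w_θ(x,z) q(x,s) = V(π). -/
/-- Unbiasedness of LIPS under a sufficient *stochastic* slate abstraction:
if for every context `x` and every `z` with `p_θ(z|x;π₀) > 0` the expected
reward `q(x,·)` is constant on `{s : p_θ(z|x,s) > 0}`, then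
`∑_x p(x) ∑_s π₀(s|x) ∑_z p_θ(z|x,s) w_θ(x,z) q(x,s) = V(π)`. -/
theorem lips_unbiased_stochastic_sufficient
    {X S Z : Type*} [Fintype X] [Fintype S] [Fintype Z] [Nonempty X] [Nonempty S]
    (p : X → ℝ) (hp0 : ∀ x, 0 ≤ p x) (hp1 : ∑ x, p x = 1)
    (pi pi0 : X → S → ℝ)
    (hpi0 : ∀ x s, 0 ≤ pi x s) (hpi1 : ∀ x, ∑ s, pi x s = 1)
    (hpi0pos : ∀ x s, 0 < pi0 x s) (hpi01 : ∀ x, ∑ s, pi0 x s = 1)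
    (q : X → S → ℝ)
    (ptheta : X → S → Z → ℝ)
    (hpt0 : ∀ x s z, 0 ≤ ptheta x s z) (hpt1 : ∀ x s, ∑ z, ptheta x s z = 1)
    (marg : (X → S → ℝ) → X → Z → ℝ)
    (hmarg : ∀ mu x z, marg mu x z = ∑ s, mu x s * ptheta x s z)
    (wtheta : X → Z → ℝ) (hwtheta : ∀ x z, wtheta x z = marg pi x z / marg pi0 x z)
    (hsuff : ∀ x z, 0 < marg pi0 x z →
      ∀ s s', 0 < ptheta x s z → 0 < ptheta x s' z → q x s = q x s') :
    ∑ x, p x * ∑ s, pi0 x s * ∑ z, ptheta x s z * (wtheta x z * q x s)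
      = ∑ x, p x * ∑ s, pi x s * q x s := by
  refine Finset.sum_congr rfl fun x _ => ?_
  congr 1
  have hR : ∑ s, pi x s * q x s = ∑ z, ∑ s, pi x s * ptheta x s z * q x s := by
    rw [Finset.sum_comm]
    refine Finset.sum_congr rfl fun s _ => ?_
    rw [← Finset.sum_mul, ← Finset.mul_sum, hpt1, mul_one]
  rw [hR]
  simp only [Finset.mul_sum]
  rw [Finset.sum_comm]
  refine Finset.sum_congr rfl fun z _ => ?_
  by_cases h : ∃ s0, 0 < ptheta x s0 z
  · obtain ⟨s0, hs0⟩ := h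
    have hm : 0 < marg pi0 x z := by
      rw [hmarg]
      exact Finset.sum_pos' (fun s _ => mul_nonneg (hpi0pos x s).le (hpt0 x s z))
        ⟨s0, Finset.mem_univ _, mul_pos (hpi0pos x s0) hs0⟩
    have hq : ∀ s, ptheta x s z * q x s = ptheta x s z * q x s0 := by
      intro s
      rcases (hpt0 x s z).eq_or_lt with h0 | h0
      · rw [← h0, zero_mul, zero_mul]
      · rw [hsuff x z hm s s0 h0 hs0]
    have h1 : ∑ s, pi0 x s * (ptheta x s z * (wtheta x z * q x s))
        = marg pi0 x z * (wtheta x z * q x s0) := by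
      rw [hmarg, Finset.sum_mul]
      refine Finset.sum_congr rfl fun s _ => ?_
      linear_combination (pi0 x s * wtheta x z) * hq s
    have h2 : ∑ s, pi x s * ptheta x s z * q x s = marg pi x z * q x s0 := by
      rw [hmarg, Finset.sum_mul]
      refine Finset.sum_congr rfl fun s _ => ?_
      linear_combination (pi x s) * hq s
    rw [h1, h2, hwtheta, ← mul_assoc, mul_div_cancel₀ _ hm.ne']
  · push Not at h
    refine Finset.sum_congr rfl fun s _ => ?_
    rw [le_antisymm (h s) (hpt0 x s z)]
    ring
end

section
/- Let q̂ : X × S → ℝ be a reward model that correctly captures pairwise value differences within each abstraction cluster: q(x,s) − q̂(x,s) = q(x,s') − q̂(x,s') whenever φ(s) = φ(s'). Then the OffCEM estimator is unbiased: ∑_x p(x) ∑_s π₀(s|x) · w(x,φ(s)) · ( q(x,s) − q̂(x,s) ) + ∑_x p(x) ∑_s π(s|x) q̂(x,s) = V(π), where w(x,z) := π(z|x)/π₀(z|x). -/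
/-- Unbiasedness of the OffCEM estimator: if the reward model `q̂` correctly
captures pairwise value differences within each abstraction cluster
(`q(x,s) − q̂(x,s) = q(x,s') − q̂(x,s')` whenever `φ s = φ s'`), then
`∑_x p(x) ∑_s π₀(s|x) w(x,φ(s)) (q(x,s) − q̂(x,s)) + ∑_x p(x) ∑_s π(s|x) q̂(x,s)
  = V(π)`, where `w(x,z) = π(z|x)/π₀(z|x)`. -/
theorem offcem_unbiased
    {X S Z : Type*} [Fintype X] [Fintype S] [Fintype Z] [DecidableEq Z]
    [Nonempty X] [Nonempty S]
    (p : X → ℝ) (hp0 : ∀ x, 0 ≤ p x) (hp1 : ∑ x, p x = 1)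
    (pi pi0 : X → S → ℝ)
    (hpi0 : ∀ x s, 0 ≤ pi x s) (hpi1 : ∀ x, ∑ s, pi x s = 1)
    (hpi0pos : ∀ x s, 0 < pi0 x s) (hpi01 : ∀ x, ∑ s, pi0 x s = 1)
    (q qhat : X → S → ℝ) (φ : S → Z)
    (hcal : ∀ x s s', φ s = φ s' → q x s - qhat x s = q x s' - qhat x s')
    (marg : (X → S → ℝ) → X → Z → ℝ)
    (hmarg : ∀ mu x z, marg mu x z = ∑ s ∈ Finset.univ.filter (fun s => φ s = z), mu x s) :
    (∑ x, p x * ∑ s, pi0 x s *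
        (marg pi x (φ s) / marg pi0 x (φ s) * (q x s - qhat x s)))
      + (∑ x, p x * ∑ s, pi x s * qhat x s)
      = ∑ x, p x * ∑ s, pi x s * q x s := by
  rw [← Finset.sum_add_distrib]
  refine Finset.sum_congr rfl fun x _ => ?_
  rw [← mul_add]
  congr 1
  have key : ∑ s, pi0 x s * (marg pi x (φ s) / marg pi0 x (φ s) * (q x s - qhat x s))
      = ∑ s, pi x s * (q x s - qhat x s) := by
    rw [← Finset.sum_fiberwise Finset.univ φ, ← Finset.sum_fiberwise Finset.univ φ
      (fun s => pi x s * (q x s - qhat x s))]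
    refine Finset.sum_congr rfl fun z _ => ?_
    rcases (Finset.univ.filter (fun s => φ s = z)).eq_empty_or_nonempty with h | ⟨s0, h0⟩
    · rw [h]; simp
    · have hs0 : φ s0 = z := (Finset.mem_filter.mp h0).2
      have hpos : 0 < marg pi0 x z := by
        rw [hmarg]
        exact Finset.sum_pos (fun s _ => hpi0pos x s) ⟨s0, h0⟩
      have e1 : ∑ s ∈ Finset.univ.filter (fun s => φ s = z),
          pi0 x s * (marg pi x (φ s) / marg pi0 x (φ s) * (q x s - qhat x s))
          = marg pi0 x z * (marg pi x z / marg pi0 x z * (q x s0 - qhat x s0)) := by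
        rw [hmarg pi0 x z, Finset.sum_mul, ← hmarg pi0 x z]
        refine Finset.sum_congr rfl fun s hs => ?_
        have h1 : φ s = z := (Finset.mem_filter.mp hs).2
        rw [h1, hcal x s s0 (h1.trans hs0.symm)]
      have e2 : ∑ s ∈ Finset.univ.filter (fun s => φ s = z), pi x s * (q x s - qhat x s)
          = marg pi x z * (q x s0 - qhat x s0) := by
        rw [hmarg pi x z, Finset.sum_mul]
        refine Finset.sum_congr rfl fun s hs => ?_
        have h1 : φ s = z := (Finset.mem_filter.mp hs).2
        rw [hcal x s s0 (h1.trans hs0.symm)]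
      rw [e1, e2]
      field_simp
  rw [key, ← Finset.sum_add_distrib]
  refine Finset.sum_congr rfl fun s _ => ?_
  ring
end
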